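/- Let X = {x_1, x_2, …, x_n} ⊂ ℝ^d, let 2 ≤ p < ∞, and let γ = max_{x ∈ X} ‖x‖_p. Let α be a probability distribution on X with mean μ = ∑_{i=1}^n α_i x_i, and let v_1, v_2, …, v_m be independent random vectors each distributed according to α. Then E‖(1/m) ∑_{i=1}^m v_i − μ‖_p ≤ 2√p · γ/√m. -/

import Mathlib

open Finset

/-- The `p`-norm of a vector in `ℝ^d`: `(∑ j, |x j| ^ p) ^ (1/p)`. -/
noncomputable def pnorm (p : ℝ) {d : ℕ} (x : Fin d → ℝ) : ℝ :=
  (∑ j, |x j| ^ p) ^ (1 / p)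


lemma sum_even (k : ℕ) (g : ℕ → ℝ) (h : ∀ j, g (2*j+1) = 0) :
    ∑ i ∈ range (2*k+1), g i = ∑ j ∈ range (k+1), g (2*j) := by
  induction k with
  | zero => simp
  | succ k ih =>
    rw [sum_range_succ _ (k+1), ← ih, show 2*(k+1)+1 = (2*k+1)+1+1 by ring, sum_range_succ,
      sum_range_succ, h]
    simp [mul_add]

noncomputable def cK (k : ℕ) : ℝ := (2*k).factorial / (2^k * k.factorial)

lemma cK_le (k : ℕ) : cK k ≤ (k:ℝ)^k := by
  unfold cK
  rw [div_le_iff₀ (by positivity)]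
  have := Nat.factorial_two_mul_le k
  have h2 : (((2*k).factorial : ℕ):ℝ) ≤ (((2*k)^k * k.factorial : ℕ) : ℝ) := by exact_mod_cast this
  push_cast at h2
  rw [mul_pow] at h2
  linarith

lemma cK_choose (k j : ℕ) (h : j ≤ k) :
    ((2*k).choose (2*j) : ℝ) * cK (k-j) ≤ (k.choose j : ℝ) * cK k := by
  unfold cK
  rw [Nat.cast_choose ℝ (by omega : 2*j ≤ 2*k), Nat.cast_choose ℝ h,
    show 2*k-2*j = 2*(k-j) by omega]
  have := Nat.two_pow_mul_factorial_le_factorial_two_mul j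
  have h2 : (2:ℝ)^j * j.factorial ≤ (2*j).factorial := by exact_mod_cast this
  have h3 : (2:ℝ)^k = 2^j * 2^(k-j) := by rw [← pow_add]; congr 1; omega
  rw [h3]
  have e1 : ((2*k).factorial:ℝ) / ((2*j).factorial * (2*(k-j)).factorial) *
     ((2*(k-j)).factorial / (2^(k-j) * (k-j).factorial)) =
     ((2*k).factorial:ℝ) / ((2*j).factorial * (2^(k-j) * (k-j).factorial)) := by
    have := (Nat.cast_ne_zero (R := ℝ)).2 (Nat.factorial_ne_zero (2*(k-j)))
    field_simp
  have e2 : (k.factorial:ℝ) / (j.factorial * (k-j).factorial) *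
     ((2*k).factorial / (2^j*2^(k-j) * k.factorial)) =
     ((2*k).factorial:ℝ) / ((2^j * j.factorial) * (2^(k-j) * (k-j).factorial)) := by
    have := (Nat.cast_ne_zero (R := ℝ)).2 (Nat.factorial_ne_zero k)
    field_simp
  rw [e1, e2]
  gcongr

def sg (b : Bool) : ℝ := if b then 1 else -1

lemma two_pt (k : ℕ) (S b : ℝ) : (b+S)^(2*k) + (-b+S)^(2*k) =
    2 * ∑ j ∈ range (k+1), ((2*k).choose (2*j) : ℝ) * (b^2)^j * S^(2*(k-j)) := by
  rw [add_pow, add_pow, ← sum_add_distrib, sum_even, mul_sum]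
  · refine sum_congr rfl fun j hj => ?_
    rw [show 2*k-2*j = 2*(k-j) by omega, pow_mul, pow_mul (-b), neg_sq]
    ring
  · intro j
    rw [pow_succ, pow_succ (-b), pow_mul, pow_mul (-b), neg_sq]
    ring

lemma even_moment (m : ℕ) : ∀ (k : ℕ) (a : Fin m → ℝ),
    ∑ s : Fin m → Bool, (∑ i, sg (s i) * a i)^(2*k) ≤ 2^m * (cK k * (∑ i, a i^2)^k) := by
  induction m with
  | zero =>
    intro k a
    rcases k with _ | k <;> simp [cK]
  | succ m ih =>
    intro k a
    rw [← (Fin.consEquiv (fun _ => Bool)).sum_comp, Fintype.sum_prod_type]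
    simp only [Fin.consEquiv, Equiv.coe_fn_mk, Fin.sum_univ_succ, Fin.cons_zero, Fin.cons_succ,
      Fintype.sum_bool]
    rw [← sum_add_distrib]
    simp only [sg, if_true, Bool.false_eq_true, if_false, one_mul, neg_one_mul]
    simp only [two_pt]
    rw [← mul_sum, sum_comm]
    rw [add_pow, pow_succ' 2 m]
    rw [mul_assoc]
    refine mul_le_mul_of_nonneg_left ?_ (by norm_num)
    rw [mul_sum, mul_sum]
    refine sum_le_sum fun j hj => ?_
    rw [← mul_sum]
    have hj : j ≤ k := by simpa [Nat.lt_succ_iff] using hj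
    have h1 := ih (k-j) (fun i => a i.succ)
    have h2 := cK_choose k j hj
    simp only [sg] at h1
    calc _ ≤ ((2*k).choose (2*j) : ℝ) * (a 0^2)^j * (2^m * (cK (k-j) * (∑ i : Fin m, a i.succ^2)^(k-j))) := by
          gcongr
      _ = (((2*k).choose (2*j) : ℝ) * cK (k-j)) * ((a 0^2)^j * 2^m * (∑ i : Fin m, a i.succ^2)^(k-j)) := by ring
      _ ≤ ((k.choose j : ℝ) * cK k) * ((a 0^2)^j * 2^m * (∑ i : Fin m, a i.succ^2)^(k-j)) := by
          gcongr
      _ = _ := by ring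

lemma khin (m : ℕ) (p : ℝ) (hp : 2 ≤ p) (a : Fin m → ℝ) :
    ∑ s : Fin m → Bool, ((2:ℝ)^m)⁻¹ * |∑ i, sg (s i) * a i| ^ p ≤ (p * ∑ i, a i^2) ^ (p/2) := by
  set k := ⌈p/2⌉₊ with hk
  have hk1 : p/2 ≤ k := Nat.le_ceil _
  have hk2 : (k:ℝ) ≤ p := by
    have := Nat.ceil_lt_add_one (a := p/2) (by linarith)
    linarith
  have hp0 : 0 < p := by linarith
  have hσ : 0 ≤ ∑ i, a i^2 := by positivity
  have hr : 1 ≤ 2*k/p := by rw [le_div_iff₀ hp0]; linarith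
  have hJ := Real.rpow_arith_mean_le_arith_mean_rpow (univ : Finset (Fin m → Bool))
    (fun _ => ((2:ℝ)^m)⁻¹) (fun s => |∑ i, sg (s i) * a i| ^ p) (fun _ _ => by positivity)
    (by simp) (fun _ _ => by positivity) hr
  rw [← Real.rpow_le_rpow_iff (z := 2*k/p) (by positivity) (by positivity) (by linarith)]
  refine hJ.trans ?_
  rw [← Real.rpow_mul (by positivity), show p/2*(2*k/p) = (k:ℝ) by field_simp, Real.rpow_natCast]
  have e : ∀ t : ℝ, (|t|^p)^(2*k/p) = t^(2*k) := by
    intro t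
    rw [← Real.rpow_mul (abs_nonneg t), show p*(2*k/p) = ((2*k:ℕ):ℝ) by push_cast; field_simp,
      Real.rpow_natCast, pow_mul, sq_abs, ← pow_mul]
  simp only [e]
  rw [← mul_sum, inv_mul_le_iff₀ (by positivity)]
  refine (even_moment m k a).trans ?_
  rw [mul_pow]
  gcongr
  exact (cK_le k).trans (by gcongr)

lemma pnorm_nonneg' (p : ℝ) {d : ℕ} (x : Fin d → ℝ) : 0 ≤ pnorm p x := by
  unfold pnorm; positivity

lemma pnorm_pow (p : ℝ) (hp : 2 ≤ p) {d : ℕ} (x : Fin d → ℝ) : pnorm p x ^ p = ∑ j, |x j| ^ p := by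
  unfold pnorm
  rw [← Real.rpow_mul (by positivity), one_div_mul_cancel (by linarith), Real.rpow_one]

lemma pnorm_eq (p : ℝ) (hp : 2 ≤ p) {d : ℕ} (x : Fin d → ℝ) :
    pnorm p x = ‖WithLp.toLp (ENNReal.ofReal p) x‖ := by
  have h : (ENNReal.ofReal p).toReal = p := ENNReal.toReal_ofReal (by linarith)
  rw [PiLp.norm_eq_sum (by rw [h]; linarith), h]
  simp [pnorm]

lemma fact_p (p : ℝ) (hp : 2 ≤ p) : Fact (1 ≤ ENNReal.ofReal p) :=
  ⟨by rw [ENNReal.one_le_ofReal]; linarith⟩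

lemma pnorm_sum_le (p : ℝ) (hp : 2 ≤ p) {d : ℕ} {ι : Type*} (s : Finset ι) (x : ι → Fin d → ℝ) :
    pnorm p (∑ i ∈ s, x i) ≤ ∑ i ∈ s, pnorm p (x i) := by
  have := fact_p p hp
  simp only [pnorm_eq p hp, WithLp.toLp_sum]
  exact norm_sum_le _ _

lemma pnorm_sub_le (p : ℝ) (hp : 2 ≤ p) {d : ℕ} (x y : Fin d → ℝ) :
    pnorm p (x - y) ≤ pnorm p x + pnorm p y := by
  have := fact_p p hp
  simp only [pnorm_eq p hp, WithLp.toLp_sub]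
  exact norm_sub_le _ _

lemma pnorm_smul (p : ℝ) (hp : 2 ≤ p) {d : ℕ} (c : ℝ) (hc : 0 ≤ c) (x : Fin d → ℝ) :
    pnorm p (c • x) = c * pnorm p x := by
  have := fact_p p hp
  simp only [pnorm_eq p hp, WithLp.toLp_smul, norm_smul, Real.norm_of_nonneg hc]

lemma vec_khin (d m : ℕ) (hm : 0 < m) (p γ : ℝ) (hp : 2 ≤ p) (hγ0 : 0 ≤ γ)
    (v : Fin m → Fin d → ℝ) (hv : ∀ i, pnorm p (v i) ≤ γ) :
    ∑ s : Fin m → Bool, ((2:ℝ)^m)⁻¹ * pnorm p (∑ i, sg (s i) • v i) ≤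
      Real.sqrt p * γ * Real.sqrt m := by
  have hp0 : 0 < p := by linarith
  have hm0 : (0:ℝ) < m := by exact_mod_cast hm
  have hJ := Real.rpow_arith_mean_le_arith_mean_rpow (univ : Finset (Fin m → Bool))
    (fun _ => ((2:ℝ)^m)⁻¹) (fun s => pnorm p (∑ i, sg (s i) • v i)) (fun _ _ => by positivity)
    (by simp) (fun _ _ => pnorm_nonneg' _ _) (by linarith : 1 ≤ p)
  rw [← Real.rpow_le_rpow_iff (z := p)
    (sum_nonneg fun _ _ => mul_nonneg (by positivity) (pnorm_nonneg' _ _)) (by positivity) hp0]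
  refine hJ.trans ?_
  simp only [pnorm_pow p hp, mul_sum]
  rw [sum_comm]
  have h1 : ∀ j : Fin d, ∑ s : Fin m → Bool, ((2:ℝ)^m)⁻¹ * |(∑ i, sg (s i) • v i) j| ^ p ≤
      p^(p/2) * ((m:ℝ)^(p/2-1) * ∑ i, |v i j|^p) := by
    intro j
    have := khin m p hp (fun i => v i j)
    simp only [Finset.sum_apply, Pi.smul_apply, smul_eq_mul]
    refine this.trans ?_
    rw [Real.mul_rpow hp0.le (by positivity)]
    gcongr
    have h2 := Real.rpow_sum_le_const_mul_sum_rpow_of_nonneg (univ : Finset (Fin m))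
      (f := fun i => v i j ^2) (p := p/2) (by linarith) (fun _ _ => by positivity)
    rw [card_univ, Fintype.card_fin] at h2
    refine h2.trans (le_of_eq ?_)
    congr 1
    refine sum_congr rfl fun i _ => ?_
    rw [← sq_abs, ← Real.rpow_natCast, ← Real.rpow_mul (abs_nonneg _)]
    congr 1
    push_cast
    ring
  refine (sum_le_sum fun j _ => h1 j).trans ?_
  rw [← mul_sum, ← mul_sum, sum_comm]
  have h3 : ∑ i, ∑ j, |v i j|^p ≤ m * γ^p := by
    calc _ ≤ ∑ i : Fin m, γ^p := by
          refine sum_le_sum fun i _ => ?_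
          rw [← pnorm_pow p hp]
          exact Real.rpow_le_rpow (pnorm_nonneg' _ _) (hv i) hp0.le
      _ = _ := by simp
  calc _ ≤ p^(p/2) * ((m:ℝ)^(p/2-1) * (m * γ^p)) := by gcongr
    _ = _ := by
      rw [Real.mul_rpow (by positivity) (by positivity), Real.mul_rpow (by positivity) (by positivity),
        Real.sqrt_eq_rpow, Real.sqrt_eq_rpow, ← Real.rpow_mul hp0.le, ← Real.rpow_mul hm0.le,
        Real.rpow_sub_one hm0.ne', show 1/2*p = p/2 by ring]
      field_simp

lemma wsum (m n : ℕ) (α : Fin n → ℝ) (hα1 : ∑ i, α i = 1) :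
    ∑ f : Fin m → Fin n, ∏ i, α (f i) = 1 := by
  rw [← Fintype.prod_sum (fun (_ : Fin m) j => α j)]
  simp [hα1]

lemma marg (m n : ℕ) (α : Fin n → ℝ) (hα1 : ∑ i, α i = 1) (φ : Fin n → ℝ) (i : Fin m) :
    ∑ f : Fin m → Fin n, (∏ i, α (f i)) * φ (f i) = ∑ j, α j * φ j := by
  have h : ∀ f : Fin m → Fin n, (∏ i, α (f i)) * φ (f i) =
      ∏ i', (α (f i') * if i' = i then φ (f i') else 1) := by
    intro f
    rw [prod_mul_distrib]; simp
  simp only [h]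
  rw [← Fintype.prod_sum (fun (i' : Fin m) j => α j * if i' = i then φ j else 1)]
  rw [Finset.prod_eq_single i]
  · simp
  · intro b _ hb
    simp [hb, hα1]
  · simp

lemma symm_eq (d n m : ℕ) (p : ℝ) (x : Fin n → Fin d → ℝ) (α : Fin n → ℝ) (s : Fin m → Bool) :
    ∑ q : (Fin m → Fin n) × (Fin m → Fin n), ((∏ i, α (q.1 i)) * (∏ i, α (q.2 i))) *
        pnorm p (∑ i, (x (q.1 i) - x (q.2 i))) =
    ∑ q : (Fin m → Fin n) × (Fin m → Fin n), ((∏ i, α (q.1 i)) * (∏ i, α (q.2 i))) *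
        pnorm p (∑ i, sg (s i) • (x (q.1 i) - x (q.2 i))) := by
  let T : (Fin m → Fin n) × (Fin m → Fin n) → (Fin m → Fin n) × (Fin m → Fin n) :=
    fun q => (fun i => if s i then q.1 i else q.2 i, fun i => if s i then q.2 i else q.1 i)
  have hT : Function.Involutive T := by
    intro q
    ext i <;> by_cases h : s i <;> simp [T, h]
  symm
  rw [← Equiv.sum_comp hT.toPerm]
  refine sum_congr rfl fun q _ => ?_
  simp only [Function.Involutive.coe_toPerm, T]
  rw [← prod_mul_distrib, ← prod_mul_distrib]
  congr 1
  · refine prod_congr rfl fun i _ => ?_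
    by_cases h : s i <;> simp [h, mul_comm]
  · congr 1
    refine sum_congr rfl fun i _ => ?_
    by_cases h : s i <;> simp [h, sg]

/-- **Sample-mean concentration in the p-norm.** Let `X = {x 1, …, x n} ⊂ ℝ^d`,
`2 ≤ p < ∞` and `γ` an upper bound on the `p`-norms of the vectors of `X`
(in particular one may take `γ = max_i ‖x i‖_p`). Let `α` be a probability
distribution on `X` with mean `μ = ∑ i, α i • x i`, and let `v_1, …, v_m` be
i.i.d. draws from `α` (the expectation over them is the weighted sum over all
index tuples `f : Fin m → Fin n`, the tuple `f` having probability
`∏ i, α (f i)`). Then `E ‖(1/m) ∑ i, v i − μ‖_p ≤ 2 √p γ / √m`. -/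
theorem sample_mean_pnorm_bound (d n m : ℕ) (hm : 0 < m)
    (x : Fin n → Fin d → ℝ) (p γ : ℝ) (hp : 2 ≤ p)
    (hγ : ∀ i, pnorm p (x i) ≤ γ)
    (α : Fin n → ℝ) (hα0 : ∀ i, 0 ≤ α i) (hα1 : ∑ i, α i = 1)
    (μ : Fin d → ℝ) (hμ : μ = ∑ i, α i • x i) :
    ∑ f : Fin m → Fin n,
        (∏ i, α (f i)) * pnorm p ((m : ℝ)⁻¹ • ∑ i, x (f i) - μ)
      ≤ 2 * Real.sqrt p * γ / Real.sqrt m := by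
  have hp0 : 0 < p := by linarith
  have hm0 : (0:ℝ) < m := by exact_mod_cast hm
  have hγ0 : 0 ≤ γ := by
    rcases Nat.eq_zero_or_pos n with h | h
    · subst h; simp at hα1
    · exact (pnorm_nonneg' _ _).trans (hγ ⟨0, h⟩)
  set w : (Fin m → Fin n) → ℝ := fun f => ∏ i, α (f i) with hw
  have hw0 : ∀ f, 0 ≤ w f := fun f => prod_nonneg fun i _ => hα0 _
  have hw1 : ∑ f, w f = 1 := wsum m n α hα1
  -- Jensen
  have hrep : ∀ f : Fin m → Fin n, (m:ℝ)⁻¹ • ∑ i, x (f i) - μ =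
      (m:ℝ)⁻¹ • ∑ g, w g • ∑ i, (x (f i) - x (g i)) := by
    intro f
    ext j
    simp only [Pi.sub_apply, Pi.smul_apply, Finset.sum_apply, smul_eq_mul, sum_sub_distrib, hμ,
      mul_sub]
    rw [← sum_mul, hw1, one_mul]
    congr 1
    simp only [mul_sum]
    rw [sum_comm]
    simp only [← mul_sum]
    simp only [hw, marg m n α hα1 (fun l => x l j)]
    simp
    field_simp
  have hJ : ∀ f : Fin m → Fin n, pnorm p ((m:ℝ)⁻¹ • ∑ i, x (f i) - μ) ≤
      (m:ℝ)⁻¹ * ∑ g, w g * pnorm p (∑ i, (x (f i) - x (g i))) := by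
    intro f
    rw [hrep, pnorm_smul p hp _ (by positivity)]
    gcongr
    refine (pnorm_sum_le p hp _ _).trans (le_of_eq ?_)
    exact sum_congr rfl fun g _ => pnorm_smul p hp _ (hw0 g) _
  set A := ∑ q : (Fin m → Fin n) × (Fin m → Fin n), (w q.1 * w q.2) *
        pnorm p (∑ i, (x (q.1 i) - x (q.2 i))) with hA
  have h1 : ∑ f : Fin m → Fin n, w f * pnorm p ((m : ℝ)⁻¹ • ∑ i, x (f i) - μ) ≤ (m:ℝ)⁻¹ * A := by
    rw [hA, Fintype.sum_prod_type, mul_sum]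
    refine sum_le_sum fun f _ => ?_
    refine (mul_le_mul_of_nonneg_left (hJ f) (hw0 f)).trans (le_of_eq ?_)
    simp only [mul_sum]
    exact sum_congr rfl fun g _ => by ring
  have h2 : ∀ s : Fin m → Bool, A ≤ 2 * ∑ f, w f * pnorm p (∑ i, sg (s i) • x (f i)) := by
    intro s
    rw [hA, symm_eq d n m p x α s]
    calc _ ≤ ∑ q : (Fin m → Fin n) × (Fin m → Fin n), (w q.1 * w q.2) *
          (pnorm p (∑ i, sg (s i) • x (q.1 i)) + pnorm p (∑ i, sg (s i) • x (q.2 i))) := by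
          refine sum_le_sum fun q _ => mul_le_mul_of_nonneg_left ?_ (mul_nonneg (hw0 _) (hw0 _))
          simp only [smul_sub, sum_sub_distrib]
          exact pnorm_sub_le p hp _ _
      _ = _ := by
          simp only [mul_add, sum_add_distrib, Fintype.sum_prod_type, two_mul]
          congr 1
          · refine sum_congr rfl fun f _ => ?_
            rw [← sum_mul, ← mul_sum, hw1, mul_one]
          · rw [sum_comm]
            refine sum_congr rfl fun f _ => ?_
            rw [← sum_mul, ← sum_mul, hw1, one_mul]
  have h3 : A ≤ 2 * (Real.sqrt p * γ * Real.sqrt m) := by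
    calc A = ∑ s : Fin m → Bool, ((2:ℝ)^m)⁻¹ * A := by simp
      _ ≤ ∑ s : Fin m → Bool, ((2:ℝ)^m)⁻¹ *
            (2 * ∑ f, w f * pnorm p (∑ i, sg (s i) • x (f i))) := by
          refine sum_le_sum fun s _ => mul_le_mul_of_nonneg_left (h2 s) (by positivity)
      _ = 2 * ∑ f, w f * ∑ s : Fin m → Bool, ((2:ℝ)^m)⁻¹ *
            pnorm p (∑ i, sg (s i) • x (f i)) := by
          simp only [mul_sum]
          rw [sum_comm]
          exact sum_congr rfl fun f _ => sum_congr rfl fun s _ => by ring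
      _ ≤ 2 * ∑ f, w f * (Real.sqrt p * γ * Real.sqrt m) := by
          gcongr with f _
          · exact hw0 f
          · exact vec_khin d m hm p γ hp hγ0 _ fun i => hγ _
      _ = _ := by rw [← sum_mul, hw1, one_mul]
  refine h1.trans ?_
  calc (m:ℝ)⁻¹ * A ≤ (m:ℝ)⁻¹ * (2 * (Real.sqrt p * γ * Real.sqrt m)) := by gcongr
    _ = _ := by
      have hs : Real.sqrt m ≠ 0 := (Real.sqrt_pos.2 hm0).ne'
      have hss : Real.sqrt m ^ 2 = m := Real.sq_sqrt hm0.le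
      rw [eq_div_iff hs]
      field_simp
      rw [hss, mul_comm]
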